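/- arXiv:1705.02142 — 4 statements merged into one kernel-verified Lean document; each statement's English description precedes it below -/
import Mathlib

section
/- Let ε₁, ε₂ be nonzero real numbers with |ε₁ε₂| ≠ 1, let R be a 2×2 real matrix, let Λ be the 2×2 real matrix with diagonal entries Λ_{ii} = (1/(2π))·log|ε₁ε₂| + R_{ii} and off-diagonal entries Λ_{ij} = (1/(2π))·log|ε₁| + R_{ij} (i ≠ j), and assume ℛ = ℛ(ε₁,ε₂,R) ≠ 0. Let G, X₁, X₂ be real numbers and let V be the column vector with entries V_j = G + ε₁·X_j (j = 1,2). Then Λ⁻¹·V = 2π·(1/log|ε₁ε₂|)·(log|ε₂|/ℛ)·(G, G)ᵗ + 2π·(ε₁/ℛ)·A·(X₁, X₂)ᵗ + 4π²·(1/log|ε₁ε₂|)·(1/ℛ)·adj(R)·V, where A is the 2×2 matrix with A₁₁ = A₂₂ = 1 and A₁₂ = A₂₁ = −log|ε₁|/log|ε₁ε₂|, and adj(R) is the adjugate of R. -/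
open Matrix

/-- The quantity `ℛ(ε₁, ε₂, R)` from the paper. -/
noncomputable def calR (ε₁ ε₂ : ℝ) (R : Matrix (Fin 2) (Fin 2) ℝ) : ℝ :=
  Real.log |ε₂| + Real.log |ε₁| / Real.log |ε₁ * ε₂| * Real.log |ε₂|
    - 2 * Real.pi * (R 0 1 + R 1 0) * (Real.log |ε₁| / Real.log |ε₁ * ε₂|)
    + 2 * Real.pi * (R 0 0 + R 1 1)
    + 4 * Real.pi ^ 2 * (R 0 0 * R 1 1 - R 0 1 * R 1 0) / Real.log |ε₁ * ε₂|

/-- The matrix `Λ(ε₁, ε₂)` with diagonal entries `(1/2π) log|ε₁ε₂| + R_ii` and off-diagonal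
entries `(1/2π) log|ε₁| + R_ij`. -/
noncomputable def LambdaMat (ε₁ ε₂ : ℝ) (R : Matrix (Fin 2) (Fin 2) ℝ) :
    Matrix (Fin 2) (Fin 2) ℝ :=
  !![1 / (2 * Real.pi) * Real.log |ε₁ * ε₂| + R 0 0,
     1 / (2 * Real.pi) * Real.log |ε₁| + R 0 1;
     1 / (2 * Real.pi) * Real.log |ε₁| + R 1 0,
     1 / (2 * Real.pi) * Real.log |ε₁ * ε₂| + R 1 1]

theorem log_abs_mul_ne_zero {x y : ℝ} (hx : x ≠ 0) (hy : y ≠ 0) (h : |x * y| ≠ 1) :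
    Real.log |x * y| ≠ 0 :=
  Real.log_ne_zero_of_pos_of_ne_one (abs_pos.mpr (mul_ne_zero hx hy)) h

theorem log_abs_mul {x y : ℝ} (hx : x ≠ 0) (hy : y ≠ 0) :
    Real.log |x * y| = Real.log |x| + Real.log |y| := by
  rw [abs_mul, Real.log_mul (abs_ne_zero.mpr hx) (abs_ne_zero.mpr hy)]

theorem det_LambdaMat {ε₁ ε₂ : ℝ} (hε₁ : ε₁ ≠ 0) (hε₂ : ε₂ ≠ 0) (h : |ε₁ * ε₂| ≠ 1)
    (R : Matrix (Fin 2) (Fin 2) ℝ) :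
    (LambdaMat ε₁ ε₂ R).det =
      Real.log |ε₁ * ε₂| / (4 * Real.pi ^ 2) * calR ε₁ ε₂ R := by
  have hl := log_abs_mul_ne_zero hε₁ hε₂ h
  have hb : Real.log |ε₂| = Real.log |ε₁ * ε₂| - Real.log |ε₁| := by
    rw [log_abs_mul hε₁ hε₂]; ring
  have hpi := Real.pi_ne_zero
  rw [LambdaMat, det_fin_two_of, calR, hb]
  field_simp
  ring

/-- decomposition of `Λ(ε₁,ε₂)⁻¹ V` for a vector `V = (G + ε₁ X₁, G + ε₁ X₂)ᵗ`,
assuming `ℛ(ε₁,ε₂,R) ≠ 0`. -/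
theorem stmt5 (ε₁ ε₂ : ℝ) (hε₁ : ε₁ ≠ 0) (hε₂ : ε₂ ≠ 0) (h1 : |ε₁ * ε₂| ≠ 1)
    (R : Matrix (Fin 2) (Fin 2) ℝ) (hR : calR ε₁ ε₂ R ≠ 0)
    (G X₁ X₂ : ℝ) (V : Fin 2 → ℝ) (hV : V = ![G + ε₁ * X₁, G + ε₁ * X₂]) :
    (LambdaMat ε₁ ε₂ R)⁻¹ *ᵥ V =
      (2 * Real.pi * (1 / Real.log |ε₁ * ε₂|) * (Real.log |ε₂| / calR ε₁ ε₂ R)) • ![G, G]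
      + (2 * Real.pi * (ε₁ / calR ε₁ ε₂ R)) •
          (!![(1 : ℝ), -(Real.log |ε₁| / Real.log |ε₁ * ε₂|);
              -(Real.log |ε₁| / Real.log |ε₁ * ε₂|), 1] *ᵥ ![X₁, X₂])
      + (4 * Real.pi ^ 2 * (1 / Real.log |ε₁ * ε₂|) * (1 / calR ε₁ ε₂ R)) •
          (R.adjugate *ᵥ V) := by
  have hl := log_abs_mul_ne_zero hε₁ hε₂ h1
  have hb : Real.log |ε₂| = Real.log |ε₁ * ε₂| - Real.log |ε₁| := by
    rw [log_abs_mul hε₁ hε₂]; ring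
  have hpi := Real.pi_ne_zero
  rw [inv_def, Ring.inverse_eq_inv', det_LambdaMat hε₁ hε₂ h1, LambdaMat, adjugate_fin_two_of,
    adjugate_fin_two, hV, hb]
  generalize calR ε₁ ε₂ R = r at hR ⊢
  ext i
  fin_cases i <;>
  · simp only [Pi.add_apply, Pi.smul_apply, mulVec, dotProduct, Fin.sum_univ_two,
      Matrix.smul_apply]
    simp [-Real.log_abs, -abs_mul]
    field_simp
    ring
end

section
/- Let X, Y, Z, Z₁ be real Banach spaces, let O be an open subset of X × Y, let (x̄,ȳ) ∈ O, and let F : X × Y → Z be analytic on O with F(x̄,ȳ) = 0. Let D : Y → Z be the Fréchet derivative at ȳ of the map y ↦ F(x̄,y); assume D is injective with closed range V, and assume there exists a closed subspace V₁ of Z such that V and V₁ are complementary (Z = V ⊕ V₁). Let O₁ be an open subset of X × Y × Z containing (x̄,ȳ,0) and such that (x, y, F(x,y)) ∈ O₁ and (x, y, 0) ∈ O₁ for all (x,y) ∈ O. Let G : X × Y × Z → Z₁ be analytic on O₁, with G(x, y, F(x,y)) = 0 and G(x, y, 0) = 0 for all (x,y) ∈ O, and such that the Fréchet derivative at 0 of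 the map z ↦ G(x̄, ȳ, z) is surjective onto Z₁ and has kernel equal to V. Then there exist an open neighborhood U of x̄ in X and an open neighborhood 𝒱 of ȳ in Y with U × 𝒱 ⊆ O, and an analytic map T : U → Y with T(U) ⊆ 𝒱, such that for all (x,y) ∈ U × 𝒱, F(x,y) = 0 if and only if y = T(x). -/
open Filter Topology Set Asymptotics
open scoped ContDiff

/-- If `f` is strictly differentiable at `(a₀, 0)` and its partial derivative in the second variable
is bounded below on `ker P`, then for `(a, z)` near `(a₀, 0)` with `z ∈ ker P`, the equations
`f (a, z) = 0` and `f (a, 0) = 0` force `z = 0`. -/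
theorem HasStrictFDerivAt.eventually_eq_zero_of_bddBelow
    {A E G W : Type*}
    [NormedAddCommGroup A] [NormedSpace ℝ A]
    [NormedAddCommGroup E] [NormedSpace ℝ E]
    [NormedAddCommGroup G] [NormedSpace ℝ G]
    [NormedAddCommGroup W] [NormedSpace ℝ W]
    {f : A × E → G} {f' : A × E →L[ℝ] G} {a₀ : A} (hf : HasStrictFDerivAt f f' (a₀, 0))
    (P : E →L[ℝ] W) {C : ℝ} (hC : ∀ z, P z = 0 → ‖z‖ ≤ C * ‖f' (0, z)‖) :
    ∀ᶠ p : A × E in 𝓝 (a₀, 0), f p = 0 → f (p.1, 0) = 0 → P p.2 = 0 → p.2 = 0 := by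
  have hC' : 0 < (2 * (|C| + 1))⁻¹ := by positivity
  have ht : Tendsto (fun p : A × E => (p, (p.1, (0 : E)))) (𝓝 (a₀, 0)) (𝓝 ((a₀, 0), (a₀, 0))) :=
    Continuous.tendsto' (by fun_prop) _ _ rfl
  filter_upwards [ht.eventually (hf.isLittleO.def hC')] with p hp h₁ h₀ hP
  have h : ‖f' (0, p.2)‖ ≤ (2 * (|C| + 1))⁻¹ * ‖p.2‖ := by
    have hsub : p - (p.1, 0) = (0, p.2) := by ext <;> simp
    simpa [h₁, h₀, hsub] using hp
  have h2 : ‖p.2‖ ≤ (|C| + 1) * ((2 * (|C| + 1))⁻¹ * ‖p.2‖) :=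
    (hC _ hP).trans (mul_le_mul ((le_abs_self C).trans (by linarith)) h (norm_nonneg _)
      (by positivity))
  have h3 : (|C| + 1) * ((2 * (|C| + 1))⁻¹ * ‖p.2‖) = ‖p.2‖ / 2 := by field_simp
  exact norm_le_zero_iff.1 (by linarith)

/-- A surjection between Banach spaces whose kernel lies in the range of a left-invertible map `D` is
bounded below on the kernel of the left inverse of `D`. -/
theorem ContinuousLinearMap.exists_norm_le_of_ker_le_range
    {Y Z Z₁ : Type*}
    [NormedAddCommGroup Y] [NormedSpace ℝ Y]
    [NormedAddCommGroup Z] [NormedSpace ℝ Z] [CompleteSpace Z]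
    [NormedAddCommGroup Z₁] [NormedSpace ℝ Z₁] [CompleteSpace Z₁]
    {L : Z →L[ℝ] Z₁} (hL : Function.Surjective L) {D : Y →L[ℝ] Z} {P : Z →L[ℝ] Y}
    (hPD : Function.LeftInverse P D)
    (hker : LinearMap.ker (L : Z →ₗ[ℝ] Z₁) ≤ LinearMap.range (D : Y →ₗ[ℝ] Z)) :
    ∃ C : ℝ, ∀ z, P z = 0 → ‖z‖ ≤ C * ‖L z‖ := by
  obtain ⟨C, -, hC⟩ := L.exists_preimage_norm_le hL
  refine ⟨(1 + ‖D ∘L P‖) * C, fun z hz => ?_⟩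
  obtain ⟨w, hw, hwC⟩ := hC (L z)
  obtain ⟨y, hy⟩ := hker (show z - w ∈ LinearMap.ker (L : Z →ₗ[ℝ] Z₁) by simp [hw])
  replace hy : D y = z - w := hy
  have hyw : y = -P w := by rw [← hPD y, hy]; simp [hz]
  have hzw : z = w - (D ∘L P) w := by
    rw [eq_comm, ← sub_eq_zero]
    have : D y = -D (P w) := by rw [hyw, map_neg]
    rw [this] at hy
    simp only [ContinuousLinearMap.comp_apply]
    rw [sub_eq_add_neg w, hy]; abel
  calc ‖z‖ ≤ ‖w‖ + ‖(D ∘L P) w‖ := by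
        conv_lhs => rw [hzw]
        exact norm_sub_le _ _
    _ ≤ ‖w‖ + ‖D ∘L P‖ * ‖w‖ := by gcongr; exact (D ∘L P).le_opNorm w
    _ = (1 + ‖D ∘L P‖) * ‖w‖ := by ring
    _ ≤ (1 + ‖D ∘L P‖) * (C * ‖L z‖) := by gcongr
    _ = _ := by ring

/-- a corollary of the implicit function theorem for real analytic maps
between Banach spaces (Lanza de Cristoforis). -/
theorem stmt11
    {X Y Z Z₁ : Type*}
    [NormedAddCommGroup X] [NormedSpace ℝ X] [CompleteSpace X]
    [NormedAddCommGroup Y] [NormedSpace ℝ Y] [CompleteSpace Y]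
    [NormedAddCommGroup Z] [NormedSpace ℝ Z] [CompleteSpace Z]
    [NormedAddCommGroup Z₁] [NormedSpace ℝ Z₁] [CompleteSpace Z₁]
    (O : Set (X × Y)) (hO : IsOpen O) (x₀ : X) (y₀ : Y) (hxy : (x₀, y₀) ∈ O)
    (F : X × Y → Z) (hF : AnalyticOnNhd ℝ F O) (hF0 : F (x₀, y₀) = 0)
    (D : Y →L[ℝ] Z) (hD : HasFDerivAt (fun y => F (x₀, y)) D y₀)
    (hDinj : Function.Injective D)
    (hDclosed : IsClosed ((LinearMap.range (D : Y →ₗ[ℝ] Z) : Submodule ℝ Z) : Set Z))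
    (V₁ : Submodule ℝ Z) (hV₁closed : IsClosed (V₁ : Set Z))
    (hcompl : IsCompl (LinearMap.range (D : Y →ₗ[ℝ] Z)) V₁)
    (O₁ : Set (X × Y × Z)) (hO₁ : IsOpen O₁) (hxy0 : (x₀, y₀, (0 : Z)) ∈ O₁)
    (hO₁F : ∀ p ∈ O, (p.1, p.2, F p) ∈ O₁)
    (hO₁0 : ∀ p ∈ O, (p.1, p.2, (0 : Z)) ∈ O₁)
    (G : X × Y × Z → Z₁) (hG : AnalyticOnNhd ℝ G O₁)
    (hGF : ∀ p ∈ O, G (p.1, p.2, F p) = 0)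
    (hG0 : ∀ p ∈ O, G (p.1, p.2, (0 : Z)) = 0)
    (DG : Z →L[ℝ] Z₁) (hDG : HasFDerivAt (fun z => G (x₀, y₀, z)) DG 0)
    (hDGsurj : Function.Surjective DG)
    (hker : LinearMap.ker (DG : Z →ₗ[ℝ] Z₁) = LinearMap.range (D : Y →ₗ[ℝ] Z)) :
    ∃ (U : Set X) (𝒱 : Set Y) (T : X → Y),
      IsOpen U ∧ x₀ ∈ U ∧ IsOpen 𝒱 ∧ y₀ ∈ 𝒱 ∧ U ×ˢ 𝒱 ⊆ O ∧
      AnalyticOnNhd ℝ T U ∧ Set.MapsTo T U 𝒱 ∧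
      ∀ x ∈ U, ∀ y ∈ 𝒱, (F (x, y) = 0 ↔ y = T x) := by
  obtain ⟨P, hPD⟩ : D.HasLeftInverse :=
    .of_injective_of_isClosed_range_of_closedComplement_range hDinj hDclosed
      (.of_isCompl_isClosed hcompl hDclosed hV₁closed)
  obtain ⟨C, hC⟩ := ContinuousLinearMap.exists_norm_le_of_ker_le_range hDGsurj hPD hker.le
  have hFa := hF _ hxy
  have hFc : ContDiffAt ℝ ω (P ∘ F) (x₀, y₀) :=
    ((P.analyticAt _).comp hFa).contDiffAt
  have hinv : (fderiv ℝ (P ∘ F) (x₀, y₀) ∘L .inr ℝ X Y).IsInvertible := by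
    have h₁ : HasFDerivAt (fun y => P (F (x₀, y)))
        (fderiv ℝ (P ∘ F) (x₀, y₀) ∘L .inr ℝ X Y) y₀ :=
      (hFc.differentiableAt (by simp)).hasFDerivAt.comp y₀ (hasFDerivAt_prodMk_right x₀ y₀)
    have h₂ : HasFDerivAt (fun y => P (F (x₀, y))) (P ∘L D) y₀ := P.hasFDerivAt.comp y₀ hD
    rw [h₁.unique h₂, show P ∘L D = .id ℝ Y from ContinuousLinearMap.ext hPD]
    exact ContinuousLinearMap.isInvertible_equiv (f := .refl ℝ Y)
  let T := hFc.implicitFunction (by simp) hinv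
  have hT : ContDiffAt ℝ ω T x₀ := hFc.contDiffAt_implicitFunction (by simp) hinv
  have hT0 : T x₀ = y₀ := hFc.implicitFunction_apply_self (by simp) hinv
  have hTiff : ∀ᶠ p in 𝓝 (x₀, y₀), P (F p) = 0 ↔ T p.1 = p.2 := by
    simpa [hF0] using hFc.eventually_apply_eq_iff_implicitFunction (by simp) hinv
  have hGz : ∀ᶠ p in 𝓝 (x₀, y₀), P (F p) = 0 → F p = 0 := by
    let e : ((X × Y) × Z) ≃L[ℝ] (X × Y × Z) := .prodAssoc ℝ X Y Z
    have hGs : HasStrictFDerivAt (G ∘ e) (fderiv ℝ G (x₀, y₀, 0) ∘L e) ((x₀, y₀), 0) :=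
      HasStrictFDerivAt.comp (g := G) (f := e) ((x₀, y₀), (0 : Z))
        (hG _ hxy0).hasStrictFDerivAt e.hasStrictFDerivAt
    have hDG' : (fderiv ℝ G (x₀, y₀, 0) ∘L e) ∘L .inr ℝ (X × Y) Z = DG :=
      (hGs.hasFDerivAt.comp (0 : Z) (hasFDerivAt_prodMk_right (x₀, y₀) 0)).unique hDG
    have hev := hGs.eventually_eq_zero_of_bddBelow P (C := C) fun z hz => by
      simpa [← hDG'] using hC z hz
    have ht : Tendsto (fun p => (p, F p)) (𝓝 (x₀, y₀)) (𝓝 ((x₀, y₀), 0)) := by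
      simpa [hF0] using tendsto_id.prodMk_nhds hFa.continuousAt.tendsto
    filter_upwards [ht.eventually hev, hO.mem_nhds hxy] with p hp hpO
    exact hp (hGF p hpO) (hG0 p hpO)
  have hall : ∀ᶠ p in 𝓝 (x₀, y₀), p ∈ O ∧ (F p = 0 ↔ p.2 = T p.1) := by
    filter_upwards [hO.mem_nhds hxy, hTiff, hGz] with p hpO hp hpz
    exact ⟨hpO, fun h => (hp.1 (by simp [h])).symm, fun h => hpz (hp.2 h.symm)⟩
  obtain ⟨U, 𝒱, hU, hxU, hV, hyV, hUV⟩ := mem_nhds_prod_iff'.1 hall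
  have hTev : ∀ᶠ x in 𝓝 x₀, x ∈ U ∧ T x ∈ 𝒱 ∧ AnalyticAt ℝ T x := by
    have hTV : ∀ᶠ x in 𝓝 x₀, T x ∈ 𝒱 := hT.continuousAt (hV.mem_nhds (by rwa [hT0]))
    exact (hU.eventually_mem hxU).and (hTV.and hT.analyticAt.eventually_analyticAt)
  obtain ⟨U', hU', hU'o, hxU'⟩ := eventually_nhds_iff.1 hTev
  refine ⟨U', 𝒱, T, hU'o, hxU', hV, hyV, ?_, fun x hx => (hU' x hx).2.2,
    fun x hx => (hU' x hx).2.1, fun x hx y hy => (hUV (mk_mem_prod (hU' x hx).1 hy)).2⟩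
  exact fun p hp => (hUV (mk_mem_prod (hU' _ hp.1).1 hp.2)).1
end

section
/- Let δ, δ₂ ∈ (0,1) and let γ : (0,δ) → (0,δ₂) satisfy γ(t) → 0 and log t/log(t·γ(t)) → λ₀ ∈ ℝ as t → 0⁺, with λ₀ ≠ −1. Let u°ₓ, Gₓ ∈ ℝ, let U, F₁, F₂, X₁, X₂, V₁, V₂ : ℝ² → ℝ and let R from ℝ² to the 2×2 real matrices all be continuous at (0,0). For t ∈ (0,δ) with ℛ(t) ≠ 0, define u(t) = u°ₓ + t·γ(t)·U(t,γ(t)) + 2π·(1/log(t·γ(t)))·(log γ(t)/ℛ(t))·(F₁(t,γ(t)) + F₂(t,γ(t)))·Gₓ + 2π·(t/ℛ(t))·(F₁(t,γ(t))·(X₁(t,γ(t)) − r(t)·X₂(t,γ(t))) + F₂(t,γ(t))·(X₂(t,γ(t)) − r(t)·X₁(t,γ(t)))) + 4π²·(1/(log(t·γ(t))·ℛ(t)))·(F₁(t,γ(t)), F₂(t,γ(t)))·adj(R(t,γ(t)))·(V₁(t,γ(t)), V₂(t,γ(t)))ᵗ, where r(t) = log t/log(t·γ(t)) and ℛ(t)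 = log γ(t) + r(t)·log γ(t) − 2π(R₁₂+R₂₁)(t,γ(t))·r(t) + 2π(R₁₁+R₂₂)(t,γ(t)) + 4π²·det R(t,γ(t))/log(t·γ(t)). Then u(t) = u°ₓ + (1/log(t·γ(t)))·(2π/(1+λ₀))·(F₁(0,0) + F₂(0,0))·Gₓ + o(1/log(t·γ(t))) as t → 0⁺. -/
open Filter Topology Asymptotics Matrix

/-- The quotient `r(t) = log t / log (t γ(t))`. -/
noncomputable def rQ (γ : ℝ → ℝ) (t : ℝ) : ℝ := Real.log t / Real.log (t * γ t)

/-- The quantity `ℛ(t) = log γ(t) + r(t) log γ(t) − 2π(R₁₂+R₂₁)(t,γ(t)) r(t)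
+ 2π(R₁₁+R₂₂)(t,γ(t)) + 4π² det R(t,γ(t)) / log(t γ(t))`. -/
noncomputable def calRt (γ : ℝ → ℝ) (R : ℝ × ℝ → Matrix (Fin 2) (Fin 2) ℝ) (t : ℝ) : ℝ :=
  Real.log (γ t) + rQ γ t * Real.log (γ t)
    - 2 * Real.pi * (R (t, γ t) 0 1 + R (t, γ t) 1 0) * rQ γ t
    + 2 * Real.pi * (R (t, γ t) 0 0 + R (t, γ t) 1 1)
    + 4 * Real.pi ^ 2 * (R (t, γ t)).det / Real.log (t * γ t)

/-- The function `u(t)` given by the representation formula of the paper. -/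
noncomputable def uFun (γ : ℝ → ℝ) (uox Gx : ℝ) (U F₁ F₂ X₁ X₂ V₁ V₂ : ℝ × ℝ → ℝ)
    (R : ℝ × ℝ → Matrix (Fin 2) (Fin 2) ℝ) (t : ℝ) : ℝ :=
  uox + t * γ t * U (t, γ t)
    + 2 * Real.pi * (1 / Real.log (t * γ t)) * (Real.log (γ t) / calRt γ R t)
        * (F₁ (t, γ t) + F₂ (t, γ t)) * Gx
    + 2 * Real.pi * (t / calRt γ R t)
        * (F₁ (t, γ t) * (X₁ (t, γ t) - rQ γ t * X₂ (t, γ t))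
          + F₂ (t, γ t) * (X₂ (t, γ t) - rQ γ t * X₁ (t, γ t)))
    + 4 * Real.pi ^ 2 * (1 / (Real.log (t * γ t) * calRt γ R t))
        * (![F₁ (t, γ t), F₂ (t, γ t)] ⬝ᵥ
            ((R (t, γ t)).adjugate *ᵥ ![V₁ (t, γ t), V₂ (t, γ t)]))

/-- The quotient `log γ(t) / ℛ(t)` tends to `1 / (1 + λ₀)`. -/
lemma tendsto_log_div_calRt {γ : ℝ → ℝ} {R : ℝ × ℝ → Matrix (Fin 2) (Fin 2) ℝ} {l : Filter ℝ}
    {lam₀ : ℝ} {R₀ : Matrix (Fin 2) (Fin 2) ℝ} (hlam₀ : lam₀ ≠ -1)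
    (hr : Tendsto (rQ γ) l (𝓝 lam₀)) (hR : Tendsto (fun t => R (t, γ t)) l (𝓝 R₀))
    (hlog : Tendsto (fun t => Real.log (γ t)) l atBot)
    (hL : Tendsto (fun t => Real.log (t * γ t)) l atBot) :
    Tendsto (fun t => Real.log (γ t) / calRt γ R t) l (𝓝 (1 / (1 + lam₀))) := by
  have hne : 1 + lam₀ ≠ 0 := fun h => hlam₀ (by linarith)
  have hE (i j : Fin 2) : Tendsto (fun t => R (t, γ t) i j) l (𝓝 (R₀ i j)) :=
    ((continuous_id.matrix_elem i j).tendsto R₀).comp hR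
  have hdet : Tendsto (fun t => (R (t, γ t)).det) l (𝓝 R₀.det) :=
    (continuous_id.matrix_det.tendsto R₀).comp hR
  have hquot : Tendsto (fun t => calRt γ R t / Real.log (γ t)) l (𝓝 (1 + lam₀)) := by
    have hbdd := (((((hE 0 1).add (hE 1 0)).const_mul (2 * Real.pi)).mul hr).neg.add
      (((hE 0 0).add (hE 1 1)).const_mul (2 * Real.pi))).add
      ((hdet.const_mul (4 * Real.pi ^ 2)).mul (tendsto_inv_atBot_zero.comp hL))
    have hsum := (hr.const_add 1).add (hbdd.mul (tendsto_inv_atBot_zero.comp hlog))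
    rw [mul_zero, add_zero] at hsum
    refine hsum.congr' ?_
    filter_upwards [hlog.eventually_lt_atBot 0] with t ht
    simp only [calRt, Function.comp_apply]
    field_simp [ht.ne]
    ring
  simpa only [one_div, inv_div] using hquot.inv₀ hne

/-- first-order asymptotic behaviour of `u(t)` as `t → 0⁺` in the case
`γ(t) → 0`, `log t / log(t γ(t)) → λ₀ ≠ −1`. -/
theorem stmt12 (δ δ₂ : ℝ) (hδ : δ ∈ Set.Ioo (0 : ℝ) 1) (hδ₂ : δ₂ ∈ Set.Ioo (0 : ℝ) 1)
    (γ : ℝ → ℝ) (hγ : ∀ t ∈ Set.Ioo 0 δ, γ t ∈ Set.Ioo 0 δ₂)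
    (hγ0 : Tendsto γ (𝓝[>] 0) (𝓝 0)) (lam₀ : ℝ) (hlam₀ : lam₀ ≠ -1)
    (hlam : Tendsto (fun t => Real.log t / Real.log (t * γ t)) (𝓝[>] 0) (𝓝 lam₀))
    (uox Gx : ℝ) (U F₁ F₂ X₁ X₂ V₁ V₂ : ℝ × ℝ → ℝ)
    (R : ℝ × ℝ → Matrix (Fin 2) (Fin 2) ℝ)
    (hU : ContinuousAt U (0, 0)) (hF₁ : ContinuousAt F₁ (0, 0))
    (hF₂ : ContinuousAt F₂ (0, 0)) (hX₁ : ContinuousAt X₁ (0, 0))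
    (hX₂ : ContinuousAt X₂ (0, 0)) (hV₁ : ContinuousAt V₁ (0, 0))
    (hV₂ : ContinuousAt V₂ (0, 0)) (hR : ContinuousAt R (0, 0)) :
    (fun t => uFun γ uox Gx U F₁ F₂ X₁ X₂ V₁ V₂ R t
        - (uox + 1 / Real.log (t * γ t) * (2 * Real.pi / (1 + lam₀))
            * (F₁ (0, 0) + F₂ (0, 0)) * Gx))
      =o[𝓝[>] 0] fun t => 1 / Real.log (t * γ t) := by
  have hlog0 : Tendsto Real.log (𝓝[>] 0) atBot := Real.tendsto_log_nhdsGT_zero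
  have hid : Tendsto (fun t : ℝ => t) (𝓝[>] 0) (𝓝 0) :=
    tendsto_nhdsWithin_of_tendsto_nhds tendsto_id
  have hpos : ∀ᶠ t : ℝ in 𝓝[>] 0, 0 < t ∧ 0 < γ t := by
    filter_upwards [Ioo_mem_nhdsGT hδ.1] with t ht using ⟨ht.1, (hγ t ht).1⟩
  have hγlog : Tendsto (fun t => Real.log (γ t)) (𝓝[>] 0) atBot :=
    hlog0.comp (tendsto_nhdsWithin_iff.2 ⟨hγ0, hpos.mono fun _ h => h.2⟩)
  have htγ : Tendsto (fun t => t * γ t) (𝓝[>] 0) (𝓝[>] 0) :=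
    tendsto_nhdsWithin_iff.2 ⟨by simpa using hid.mul hγ0, hpos.mono fun _ h => mul_pos h.1 h.2⟩
  have hL : Tendsto (fun t => Real.log (t * γ t)) (𝓝[>] 0) atBot := hlog0.comp htγ
  have hxlog : Tendsto (fun x : ℝ => x * Real.log x) (𝓝[>] 0) (𝓝 0) := by
    simpa using (Real.continuous_mul_log.tendsto 0).mono_left nhdsWithin_le_nhds
  have hpt : Tendsto (fun t => (t, γ t)) (𝓝[>] 0) (𝓝 ((0 : ℝ), (0 : ℝ))) := hid.prodMk_nhds hγ0
  have hr : Tendsto (rQ γ) (𝓝[>] 0) (𝓝 lam₀) := hlam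
  have hq := tendsto_log_div_calRt hlam₀ hr (hR.tendsto.comp hpt) hγlog hL
  have hinv : Tendsto (fun t => 1 / calRt γ R t) (𝓝[>] 0) (𝓝 0) := by
    have h := hq.mul (tendsto_inv_atBot_zero.comp hγlog)
    rw [mul_zero] at h
    refine h.congr' ?_
    filter_upwards [hγlog.eventually_lt_atBot 0] with t ht
    simp only [Function.comp_apply]
    field_simp [ht.ne]
  have hLt : Tendsto (fun t => t * Real.log (t * γ t) / calRt γ R t) (𝓝[>] 0) (𝓝 0) := by
    have h := (hxlog.mul hinv).add (hid.mul hq)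
    rw [mul_zero, zero_mul, add_zero] at h
    refine h.congr' ?_
    filter_upwards [hpos] with t ht
    rw [Real.log_mul ht.1.ne' ht.2.ne']
    ring
  have hF₁' := hF₁.tendsto.comp hpt
  have hF₂' := hF₂.tendsto.comp hpt
  have hX₁' := hX₁.tendsto.comp hpt
  have hX₂' := hX₂.tendsto.comp hpt
  have hform : ContinuousAt (fun p => ![F₁ p, F₂ p] ⬝ᵥ ((R p).adjugate *ᵥ ![V₁ p, V₂ p]))
      ((0 : ℝ), (0 : ℝ)) := by
    have hE (i j : Fin 2) : ContinuousAt (fun p => R p i j) ((0 : ℝ), (0 : ℝ)) :=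
      (continuous_id.matrix_elem i j).continuousAt.comp hR
    have h00 := hE 0 0
    have h01 := hE 0 1
    have h10 := hE 1 0
    have h11 := hE 1 1
    simp only [adjugate_fin_two, dotProduct, mulVec, Fin.sum_univ_two, of_apply, cons_val_zero,
      cons_val_one]
    fun_prop
  have hlim := ((((hxlog.comp htγ).mul (hU.tendsto.comp hpt)).add
    ((((hq.mul (hF₁'.add hF₂')).const_mul (2 * Real.pi)).mul_const Gx).sub_const
      (2 * Real.pi / (1 + lam₀) * (F₁ (0, 0) + F₂ (0, 0)) * Gx))).add
    ((hLt.mul ((hF₁'.mul (hX₁'.sub (hr.mul hX₂'))).add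
      (hF₂'.mul (hX₂'.sub (hr.mul hX₁'))))).const_mul (2 * Real.pi))).add
    ((hinv.mul (hform.tendsto.comp hpt)).const_mul (4 * Real.pi ^ 2))
  have hL0 : ∀ᶠ t in 𝓝[>] 0, Real.log (t * γ t) ≠ 0 :=
    (hL.eventually_lt_atBot 0).mono fun _ h => h.ne
  rw [isLittleO_iff_tendsto' (hL0.mono fun t ht h => absurd h (one_div_ne_zero ht))]
  convert hlim.congr' ?_ using 2
  · ring
  · filter_upwards [hL0] with t ht
    simp only [uFun, Function.comp_apply]
    generalize ![F₁ (t, γ t), F₂ (t, γ t)] ⬝ᵥ _ = Q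
    simp only [div_eq_mul_inv, mul_inv, one_mul, inv_inv]
    generalize (calRt γ R t)⁻¹ = c
    generalize (1 + lam₀)⁻¹ = d
    field_simp
    ring
end

section
/- Let δ ∈ (0,1), δ₂ ∈ (0,1), γ₀ ∈ (0,δ₂), and let γ : (0,δ) → (0,δ₂) satisfy γ(t) → γ₀ as t → 0⁺. Let u°ₓ, Gₓ ∈ ℝ, let U, F₁, F₂, X₁, X₂, V₁, V₂ : ℝ² → ℝ and let R from ℝ² to the 2×2 real matrices all be continuous at (0,γ₀). Set ℛ₀ = 2·log γ₀ + 2π·(R₁₁(0,γ₀) + R₂₂(0,γ₀) − R₁₂(0,γ₀) − R₂₁(0,γ₀)) and assume ℛ₀ ≠ 0. For t ∈ (0,δ) with ℛ(t) ≠ 0, define u(t) = u°ₓ + t·γ(t)·U(t,γ(t)) + 2π·(1/log(t·γ(t)))·(log γ(t)/ℛ(t))·(F₁(t,γ(t)) + F₂(t,γ(t)))·Gₓ + 2π·(t/ℛ(t))·(F₁(t,γ(t))·(X₁(t,γ(t)) − r(t)·X₂(t,γ(t))) + F₂(t,γ(t))·(X₂(t,γ(t)) − r(t)·X₁(t,γ(t))))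 + 4π²·(1/(log(t·γ(t))·ℛ(t)))·(F₁(t,γ(t)), F₂(t,γ(t)))·adj(R(t,γ(t)))·(V₁(t,γ(t)), V₂(t,γ(t)))ᵗ, where r(t) = log t/log(t·γ(t)) and ℛ(t) = log γ(t) + r(t)·log γ(t) − 2π(R₁₂+R₂₁)(t,γ(t))·r(t) + 2π(R₁₁+R₂₂)(t,γ(t)) + 4π²·det R(t,γ(t))/log(t·γ(t)). Then u(t) = u°ₓ + (1/log t)·(2π/ℛ₀)·( log γ₀·(F₁(0,γ₀) + F₂(0,γ₀))·Gₓ + 2π·(F₁(0,γ₀), F₂(0,γ₀))·adj(R(0,γ₀))·(V₁(0,γ₀), V₂(0,γ₀))ᵗ ) + o(1/log t) as t → 0⁺. -/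
open Filter Topology Asymptotics Matrix

/-- If `γ` has a positive limit, then `log (t γ(t)) → -∞` as `t → 0⁺`. -/
theorem tendsto_log_mul_atBot {γ : ℝ → ℝ} {γ₀ : ℝ} (h₀ : 0 < γ₀)
    (hγ : Tendsto γ (𝓝[>] 0) (𝓝 γ₀)) :
    Tendsto (fun t => Real.log (t * γ t)) (𝓝[>] 0) atBot := by
  refine Real.tendsto_log_nhdsGT_zero.comp (tendsto_nhdsWithin_iff.2 ⟨?_, ?_⟩)
  · simpa using (tendsto_nhdsWithin_of_tendsto_nhds (tendsto_id (x := 𝓝 (0 : ℝ)))).mul hγ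
  · filter_upwards [self_mem_nhdsWithin, hγ.eventually_const_lt h₀] with t ht hγt
    exact mul_pos ht hγt

theorem tendsto_rQ {γ : ℝ → ℝ} {γ₀ : ℝ} (h₀ : 0 < γ₀) (hγ : Tendsto γ (𝓝[>] 0) (𝓝 γ₀)) :
    Tendsto (rQ γ) (𝓝[>] 0) (𝓝 1) := by
  have hL := tendsto_log_mul_atBot h₀ hγ
  have hlim : Tendsto (fun t => 1 - Real.log (γ t) / Real.log (t * γ t)) (𝓝[>] 0) (𝓝 1) := by
    simpa using tendsto_const_nhds.sub ((hγ.log h₀.ne').div_atBot hL)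
  refine hlim.congr' ?_
  filter_upwards [self_mem_nhdsWithin, hγ.eventually_const_lt h₀, hL.eventually_lt_atBot 0]
    with t ht hγt hLt
  rw [rQ, one_sub_div hLt.ne, Real.log_mul (ne_of_gt ht) hγt.ne', add_sub_cancel_right]

theorem tendsto_calRt {γ : ℝ → ℝ} {γ₀ : ℝ} (h₀ : 0 < γ₀) (hγ : Tendsto γ (𝓝[>] 0) (𝓝 γ₀))
    {R : ℝ × ℝ → Matrix (Fin 2) (Fin 2) ℝ} {M : Matrix (Fin 2) (Fin 2) ℝ}
    (hR : Tendsto (fun t => R (t, γ t)) (𝓝[>] 0) (𝓝 M)) :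
    Tendsto (calRt γ R) (𝓝[>] 0)
      (𝓝 (2 * Real.log γ₀ + 2 * Real.pi * (M 0 0 + M 1 1 - M 0 1 - M 1 0))) := by
  have hentry (i j : Fin 2) : Tendsto (fun t => R (t, γ t) i j) (𝓝[>] 0) (𝓝 (M i j)) :=
    (hR.apply_nhds i).apply_nhds j
  have hr := tendsto_rQ h₀ hγ
  have hlog := hγ.log h₀.ne'
  have hdet : Tendsto (fun t => 4 * Real.pi ^ 2 * (R (t, γ t)).det) (𝓝[>] 0)
      (𝓝 (4 * Real.pi ^ 2 * M.det)) :=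
    ((continuous_id.matrix_det.tendsto M).comp hR).const_mul _
  refine ((((hlog.add (hr.mul hlog)).sub
    ((((hentry 0 1).add (hentry 1 0)).const_mul (2 * Real.pi)).mul hr)).add
    (((hentry 0 0).add (hentry 1 1)).const_mul (2 * Real.pi))).add
    (hdet.div_atBot (tendsto_log_mul_atBot h₀ hγ))).trans_eq ?_
  congr 1
  ring

/-- first-order asymptotic behaviour of `u(t)` as `t → 0⁺` in the case
`γ(t) → γ₀ ∈ (0,δ₂)`, assuming `ℛ₀ ≠ 0`. -/
theorem stmt13 (δ δ₂ γ₀ : ℝ) (hδ : δ ∈ Set.Ioo (0 : ℝ) 1) (hδ₂ : δ₂ ∈ Set.Ioo (0 : ℝ) 1)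
    (hγ₀ : γ₀ ∈ Set.Ioo 0 δ₂)
    (γ : ℝ → ℝ) (hγ : ∀ t ∈ Set.Ioo 0 δ, γ t ∈ Set.Ioo 0 δ₂)
    (hγ0 : Tendsto γ (𝓝[>] 0) (𝓝 γ₀))
    (uox Gx : ℝ) (U F₁ F₂ X₁ X₂ V₁ V₂ : ℝ × ℝ → ℝ)
    (R : ℝ × ℝ → Matrix (Fin 2) (Fin 2) ℝ)
    (hU : ContinuousAt U (0, γ₀)) (hF₁ : ContinuousAt F₁ (0, γ₀))
    (hF₂ : ContinuousAt F₂ (0, γ₀)) (hX₁ : ContinuousAt X₁ (0, γ₀))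
    (hX₂ : ContinuousAt X₂ (0, γ₀)) (hV₁ : ContinuousAt V₁ (0, γ₀))
    (hV₂ : ContinuousAt V₂ (0, γ₀)) (hR : ContinuousAt R (0, γ₀))
    (R₀ : ℝ)
    (hR₀def : R₀ = 2 * Real.log γ₀ +
      2 * Real.pi * (R (0, γ₀) 0 0 + R (0, γ₀) 1 1 - R (0, γ₀) 0 1 - R (0, γ₀) 1 0))
    (hR₀ : R₀ ≠ 0) :
    (fun t => uFun γ uox Gx U F₁ F₂ X₁ X₂ V₁ V₂ R t
        - (uox + 1 / Real.log t * (2 * Real.pi / R₀)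
            * (Real.log γ₀ * (F₁ (0, γ₀) + F₂ (0, γ₀)) * Gx
              + 2 * Real.pi *
                (![F₁ (0, γ₀), F₂ (0, γ₀)] ⬝ᵥ
                  ((R (0, γ₀)).adjugate *ᵥ ![V₁ (0, γ₀), V₂ (0, γ₀)])))))
      =o[𝓝[>] 0] fun t => 1 / Real.log t := by
  have h₀ : 0 < γ₀ := hγ₀.1
  have hpair : Tendsto (fun t => (t, γ t)) (𝓝[>] 0) (𝓝 (0, γ₀)) :=
    (tendsto_nhdsWithin_of_tendsto_nhds tendsto_id).prodMk_nhds hγ0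
  have hr := tendsto_rQ h₀ hγ0
  have hcal : Tendsto (calRt γ R) (𝓝[>] 0) (𝓝 R₀) :=
    hR₀def ▸ tendsto_calRt h₀ hγ0 (hR.tendsto.comp hpair)
  have hlog := hγ0.log h₀.ne'
  have htlog : Tendsto (fun t => t * Real.log t) (𝓝[>] 0) (𝓝 0) := by
    simpa using (Real.continuous_mul_log.tendsto 0).mono_left nhdsWithin_le_nhds
  have hU' := hU.tendsto.comp hpair
  have hF₁' := hF₁.tendsto.comp hpair
  have hF₂' := hF₂.tendsto.comp hpair
  have hX₁' := hX₁.tendsto.comp hpair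
  have hX₂' := hX₂.tendsto.comp hpair
  have hV₁' := hV₁.tendsto.comp hpair
  have hV₂' := hV₂.tendsto.comp hpair
  have hR' := hR.tendsto.comp hpair
  have hform : Tendsto (fun t => ![F₁ (t, γ t), F₂ (t, γ t)] ⬝ᵥ
      ((R (t, γ t)).adjugate *ᵥ ![V₁ (t, γ t), V₂ (t, γ t)])) (𝓝[>] 0)
      (𝓝 (![F₁ (0, γ₀), F₂ (0, γ₀)] ⬝ᵥ
        ((R (0, γ₀)).adjugate *ᵥ ![V₁ (0, γ₀), V₂ (0, γ₀)]))) := by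
    have hadj (i j : Fin 2) : Tendsto (fun t => (R (t, γ t)).adjugate i j) (𝓝[>] 0)
        (𝓝 ((R (0, γ₀)).adjugate i j)) :=
      (((continuous_id.matrix_adjugate.tendsto _).comp hR').apply_nhds i).apply_nhds j
    simp only [dotProduct, mulVec, Fin.sum_univ_two, cons_val_zero, cons_val_one]
    exact (hF₁'.mul (((hadj 0 0).mul hV₁').add ((hadj 0 1).mul hV₂'))).add
      (hF₂'.mul (((hadj 1 0).mul hV₁').add ((hadj 1 1).mul hV₂')))
  have hne : ∀ᶠ t in 𝓝[>] (0 : ℝ), Real.log t ≠ 0 :=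
    (Real.tendsto_log_nhdsGT_zero.eventually_lt_atBot 0).mono fun _ h => h.ne
  rw [isLittleO_iff_tendsto' (hne.mono fun t ht h => absurd h (one_div_ne_zero ht))]
  have hlim := ((((htlog.mul hγ0).mul hU').add
    ((((hr.const_mul (2 * Real.pi)).mul (hlog.div hcal hR₀)).mul (hF₁'.add hF₂')).mul_const Gx)).add
    (((htlog.div hcal hR₀).const_mul (2 * Real.pi)).mul
      ((hF₁'.mul (hX₁'.sub (hr.mul hX₂'))).add (hF₂'.mul (hX₂'.sub (hr.mul hX₁')))))).add
    (((hr.div hcal hR₀).const_mul (4 * Real.pi ^ 2)).mul hform)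
  have hsub := hlim.sub_const (2 * Real.pi / R₀ * (Real.log γ₀ * (F₁ (0, γ₀) + F₂ (0, γ₀)) * Gx
    + 2 * Real.pi * (![F₁ (0, γ₀), F₂ (0, γ₀)] ⬝ᵥ
      ((R (0, γ₀)).adjugate *ᵥ ![V₁ (0, γ₀), V₂ (0, γ₀)]))))
  refine (hsub.congr' ?_).trans_eq ?_
  · filter_upwards [hne] with t ht
    simp only [uFun, Function.comp_apply, Pi.div_apply]
    generalize calRt γ R t = C
    rw [rQ]
    generalize Real.log (t * γ t) = L
    generalize Real.log t = l at *
    field_simp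
    ring
  · congr 1
    ring
end
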